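/- The logic LC⊳ is decidable: there is an algorithm (equivalently, the predicate is decidable) determining, for every formula φ, whether φ is LC⊳-valid. -/

import Mathlib

/-- Formulas: atoms, ⊤, ⊥, ∧, ∨, →, irreflexive implication ⊳ (`iimp`), later ▷ (`later`). -/
inductive Fm : Type where
  | atom : ℕ → Fm
  | top : Fm
  | bot : Fm
  | and : Fm → Fm → Fm
  | or : Fm → Fm → Fm
  | imp : Fm → Fm → Fm
  | iimp : Fm → Fm → Fm
  | later : Fm → Fm
deriving DecidableEq

/-- A KM-model: nonempty set of worlds, transitive converse-well-founded relation
(no infinite ascending chain), persistent valuation of atoms. -/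
structure KMModel where
  W : Type
  nonempty : Nonempty W
  R : W → W → Prop
  trans : ∀ {x y z}, R x y → R y z → R x z
  cwf : ¬ ∃ f : ℕ → W, ∀ n, R (f n) (f (n + 1))
  val : ℕ → W → Prop
  persist : ∀ p {w x}, val p w → R w x → val p x

/-- Kripke forcing in a KM-model. -/
def KMModel.force (M : KMModel) : Fm → M.W → Prop
  | .atom p, w => M.val p w
  | .top, _ => True
  | .bot, _ => False
  | .and a b, w => M.force a w ∧ M.force b w
  | .or a b, w => M.force a w ∨ M.force b w
  | .imp a b, w => ∀ x, (w = x ∨ M.R w x) → M.force a x → M.force b x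
  | .iimp a b, w => ∀ x, M.R w x → M.force a x → M.force b x
  | .later a, w => ∀ x, M.R w x → M.force a x

/-- An LC⊳-model is a KM-model whose relation is moreover connected. -/
structure LCModel extends KMModel where
  conn : ∀ x y : W, x = y ∨ R x y ∨ R y x

/-- KM-validity. -/
def KMValid (φ : Fm) : Prop :=
  ∀ (M : KMModel) (w : M.W), M.force φ w

/-- LC⊳-validity. -/
def LCValid (φ : Fm) : Prop :=
  ∀ (M : LCModel) (w : M.W), M.toKMModel.force φ w

/-- ω-semantics forcing (worlds are positive integers). -/
def wforce (η : ℕ → ℕ+ → Prop) : Fm → ℕ+ → Prop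
  | .atom p, j => η p j
  | .top, _ => True
  | .bot, _ => False
  | .and a b, j => wforce η a j ∧ wforce η b j
  | .or a b, j => wforce η a j ∨ wforce η b j
  | .imp a b, j => ∀ k ≤ j, wforce η a k → wforce η b k
  | .iimp a b, j => ∀ k < j, wforce η a k → wforce η b k
  | .later a, j => ∀ k < j, wforce η a k

/-- `iimps G` is the set {γ ⊳ γ' | (γ,γ') ∈ G}. -/
def iimps (G : Finset (Fm × Fm)) : Finset Fm := G.image fun p => Fm.iimp p.1 p.2

/-- `impsOf G` is the set {γ → γ' | (γ,γ') ∈ G}. -/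
def impsOf (G : Finset (Fm × Fm)) : Finset Fm := G.image fun p => Fm.imp p.1 p.2

/-- `laters Θ` is the set {▷θ | θ ∈ Θ}. -/
def laters (Θ : Finset Fm) : Finset Fm := Θ.image Fm.later

def Fm.isAtom : Fm → Prop
  | .atom _ => True
  | _ => False

/-- The sequent calculus SC_LC⊳ on sequents of finite sets of formulas. -/
inductive DerivLC : Finset Fm → Finset Fm → Prop where
  | topR (Γ Δ) : DerivLC Γ (insert Fm.top Δ)
  | botL (Γ Δ) : DerivLC (insert Fm.bot Γ) Δ
  | id (Γ Δ φ) : DerivLC (insert φ Γ) (insert φ Δ)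
  | andL (Γ Δ φ ψ) : DerivLC (insert φ (insert ψ Γ)) Δ → DerivLC (insert (φ.and ψ) Γ) Δ
  | andR (Γ Δ φ ψ) : DerivLC Γ (insert φ Δ) → DerivLC Γ (insert ψ Δ) →
      DerivLC Γ (insert (φ.and ψ) Δ)
  | orL (Γ Δ φ ψ) : DerivLC (insert φ Γ) Δ → DerivLC (insert ψ Γ) Δ →
      DerivLC (insert (φ.or ψ) Γ) Δ
  | orR (Γ Δ φ ψ) : DerivLC Γ (insert φ (insert ψ Δ)) → DerivLC Γ (insert (φ.or ψ) Δ)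
  | impL (Γ Δ φ ψ) : DerivLC (insert (φ.iimp ψ) Γ) (insert φ Δ) →
      DerivLC (insert ψ (insert (φ.iimp ψ) Γ)) Δ →
      DerivLC (insert (φ.imp ψ) Γ) Δ
  | impR (Γ Δ φ ψ) : DerivLC (insert φ Γ) (insert ψ Δ) → DerivLC Γ (insert (φ.iimp ψ) Δ) →
      DerivLC Γ (insert (φ.imp ψ) Δ)
  | step (Sl Sr Θ Φ : Finset Fm) (G D : Finset (Fm × Fm)) :
      (∀ a ∈ Sl, a.isAtom) → (∀ a ∈ Sr, a.isAtom) →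
      Sl ∩ Sr = ∅ → Fm.bot ∉ Sl → Fm.top ∉ Sr →
      (D.Nonempty ∨ Φ.Nonempty) →
      (∀ pq ∈ D, DerivLC
          (Sl ∪ impsOf G ∪ Θ ∪ laters Θ ∪ ({Fm.iimp pq.1 pq.2, pq.1} : Finset Fm))
          (insert pq.2 ((impsOf D).erase (Fm.imp pq.1 pq.2) ∪ Φ))) →
      (∀ χ ∈ Φ, DerivLC
          (Sl ∪ Θ ∪ laters Θ ∪ impsOf G ∪ ({Fm.later χ} : Finset Fm))
          (impsOf D ∪ Φ)) →
      DerivLC (Sl ∪ laters Θ ∪ iimps G) (iimps D ∪ laters Φ ∪ Sr)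

/-- The sequent calculus SC_KM: same static rules, transitional rules (⊳R) and (▷R). -/
inductive DerivKM : Finset Fm → Finset Fm → Prop where
  | topR (Γ Δ) : DerivKM Γ (insert Fm.top Δ)
  | botL (Γ Δ) : DerivKM (insert Fm.bot Γ) Δ
  | id (Γ Δ φ) : DerivKM (insert φ Γ) (insert φ Δ)
  | andL (Γ Δ φ ψ) : DerivKM (insert φ (insert ψ Γ)) Δ → DerivKM (insert (φ.and ψ) Γ) Δ
  | andR (Γ Δ φ ψ) : DerivKM Γ (insert φ Δ) → DerivKM Γ (insert ψ Δ) →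
      DerivKM Γ (insert (φ.and ψ) Δ)
  | orL (Γ Δ φ ψ) : DerivKM (insert φ Γ) Δ → DerivKM (insert ψ Γ) Δ →
      DerivKM (insert (φ.or ψ) Γ) Δ
  | orR (Γ Δ φ ψ) : DerivKM Γ (insert φ (insert ψ Δ)) → DerivKM Γ (insert (φ.or ψ) Δ)
  | impL (Γ Δ φ ψ) : DerivKM (insert (φ.iimp ψ) Γ) (insert φ Δ) →
      DerivKM (insert ψ (insert (φ.iimp ψ) Γ)) Δ →
      DerivKM (insert (φ.imp ψ) Γ) Δ
  | impR (Γ Δ φ ψ) : DerivKM (insert φ Γ) (insert ψ Δ) → DerivKM Γ (insert (φ.iimp ψ) Δ) →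
      DerivKM Γ (insert (φ.imp ψ) Δ)
  | iimpR (Sl Sr Θ Φ : Finset Fm) (G D : Finset (Fm × Fm)) (φ ψ : Fm) :
      (∀ a ∈ Sl, a.isAtom) → (∀ a ∈ Sr, a.isAtom) →
      Sl ∩ Sr = ∅ → Fm.bot ∉ Sl → Fm.top ∉ Sr →
      DerivKM (Sl ∪ Θ ∪ laters Θ ∪ impsOf G ∪ ({Fm.iimp φ ψ, φ} : Finset Fm)) {ψ} →
      DerivKM (Sl ∪ laters Θ ∪ iimps G) (insert (Fm.iimp φ ψ) (iimps D ∪ laters Φ ∪ Sr))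
  | laterR (Sl Sr Θ Φ : Finset Fm) (G D : Finset (Fm × Fm)) (φ : Fm) :
      (∀ a ∈ Sl, a.isAtom) → (∀ a ∈ Sr, a.isAtom) →
      Sl ∩ Sr = ∅ → Fm.bot ∉ Sl → Fm.top ∉ Sr →
      DerivKM (Sl ∪ Θ ∪ laters Θ ∪ impsOf G ∪ ({Fm.later φ} : Finset Fm)) {φ} →
      DerivKM (Sl ∪ laters Θ ∪ iimps G) (insert (Fm.later φ) (iimps D ∪ laters Φ ∪ Sr))

/-- A sequent is refutable (over LC⊳-models) if some world of some LC⊳-model forces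
every antecedent formula and no succedent formula. -/
def RefutableLC (Γ Δ : Finset Fm) : Prop :=
  ∃ (M : LCModel) (w : M.W),
    (∀ γ ∈ Γ, M.toKMModel.force γ w) ∧ ∀ δ ∈ Δ, ¬ M.toKMModel.force δ w

/-- A sequent is refutable (over KM-models) if some world of some KM-model forces
every antecedent formula and no succedent formula. -/
def RefutableKM (Γ Δ : Finset Fm) : Prop :=
  ∃ (M : KMModel) (w : M.W),
    (∀ γ ∈ Γ, M.force γ w) ∧ ∀ δ ∈ Δ, ¬ M.force δ w

/-- Length of a formula: number of symbol occurrences. -/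
def Fm.len : Fm → ℕ
  | .atom _ => 1
  | .top => 1
  | .bot => 1
  | .and a b => a.len + b.len + 1
  | .or a b => a.len + b.len + 1
  | .imp a b => a.len + b.len + 1
  | .iimp a b => a.len + b.len + 1
  | .later a => a.len + 1

/-- An explicit numeric code for formulas. -/
def Fm.code : Fm → ℕ
  | .atom p => Nat.pair 0 p
  | .top => Nat.pair 1 0
  | .bot => Nat.pair 2 0
  | .and a b => Nat.pair 3 (Nat.pair a.code b.code)
  | .or a b => Nat.pair 4 (Nat.pair a.code b.code)
  | .imp a b => Nat.pair 5 (Nat.pair a.code b.code)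
  | .iimp a b => Nat.pair 6 (Nat.pair a.code b.code)
  | .later a => Nat.pair 7 a.code

/-- Formulas with no ⊳ and no ▷. -/
def Fm.noModal : Fm → Prop
  | .atom _ => True
  | .top => True
  | .bot => True
  | .and a b => a.noModal ∧ b.noModal
  | .or a b => a.noModal ∧ b.noModal
  | .imp a b => a.noModal ∧ b.noModal
  | .iimp _ _ => False
  | .later _ => False

/-- Classical Boolean evaluation (junk values on the modal connectives). -/
def Fm.beval (v : ℕ → Bool) : Fm → Bool
  | .atom p => v p
  | .top => true
  | .bot => false
  | .and a b => a.beval v && b.beval v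
  | .or a b => a.beval v || b.beval v
  | .imp a b => !(a.beval v) || b.beval v
  | .iimp _ _ => false
  | .later _ => false

/-- Over a chain of depth `k` an upset is determined by its cardinality; this computes the
cardinality of the truth set of a formula from those of its atoms. -/
def Fm.lcVal (v : ℕ → ℕ) (k : ℕ) : Fm → ℕ
  | .atom p => min (v p) k
  | .top => k
  | .bot => 0
  | .and a b => min (a.lcVal v k) (b.lcVal v k)
  | .or a b => max (a.lcVal v k) (b.lcVal v k)
  | .imp a b => if a.lcVal v k ≤ b.lcVal v k then k else b.lcVal v k
  | .iimp a b => if a.lcVal v k ≤ b.lcVal v k then k else b.lcVal v k + 1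
  | .later a => min (a.lcVal v k + 1) k

theorem Fm.lcVal_le (v : ℕ → ℕ) (k : ℕ) (φ : Fm) : φ.lcVal v k ≤ k := by
  induction φ <;> grind [Fm.lcVal]

/-- The model on `ℕ` in which a world sees exactly the smaller numbers and the atom `p` holds
below `v p`. -/
def natModel (v : ℕ → ℕ) : LCModel where
  W := ℕ
  nonempty := ⟨0⟩
  R x y := y < x
  trans h₁ h₂ := lt_trans h₂ h₁
  cwf := by
    rintro ⟨f, hf⟩
    have h : ∀ n, f n + n ≤ f 0 := by
      intro n
      induction n with
      | zero => simp
      | succ n ih => have := hf n; omega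
    have := h (f 0 + 1)
    omega
  val p n := n < v p
  persist _ _ _ h₁ h₂ := lt_trans h₂ h₁
  conn x y := by omega

theorem natModel_force_iff (v : ℕ → ℕ) (k : ℕ) (φ : Fm) :
    ∀ n : ℕ, n < k → ((natModel v).toKMModel.force φ n ↔ n < φ.lcVal v k) := by
  induction φ with
  | atom p =>
    intro n hn
    change n < v p ↔ n < min (v p) k
    omega
  | top => intro n hn; simpa [KMModel.force, Fm.lcVal] using hn
  | bot => intro n hn; simp [KMModel.force, Fm.lcVal]
  | and a b iha ihb => intro n hn; simp [KMModel.force, Fm.lcVal, iha n hn, ihb n hn]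
  | or a b iha ihb => intro n hn; simp [KMModel.force, Fm.lcVal, iha n hn, ihb n hn]
  | imp a b iha ihb =>
    intro n hn
    have ha := a.lcVal_le v k
    have key : (natModel v).toKMModel.force (a.imp b) n ↔
        ∀ x : ℕ, x ≤ n → x < a.lcVal v k → x < b.lcVal v k := by
      change (∀ x : ℕ, (n = x ∨ x < n) → _ → _) ↔ _
      refine forall_congr' fun x => ?_
      constructor
      · intro h hx
        rw [← iha x (by omega), ← ihb x (by omega)]
        exact h (by omega)
      · intro h hx
        rw [iha x (by omega), ihb x (by omega)]
        exact h (by omega)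
    rw [key, Fm.lcVal]
    split_ifs with h
    · exact ⟨fun _ => hn, fun _ x _ _ => by omega⟩
    · refine ⟨fun H => ?_, fun _ x _ _ => by omega⟩
      by_contra hc
      have := H (b.lcVal v k) (by omega) (by omega)
      omega
  | iimp a b iha ihb =>
    intro n hn
    have ha := a.lcVal_le v k
    have key : (natModel v).toKMModel.force (a.iimp b) n ↔
        ∀ x : ℕ, x < n → x < a.lcVal v k → x < b.lcVal v k := by
      change (∀ x : ℕ, x < n → _ → _) ↔ _
      refine forall_congr' fun x => ?_
      constructor
      · intro h hx
        rw [← iha x (by omega), ← ihb x (by omega)]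
        exact h hx
      · intro h hx
        rw [iha x (by omega), ihb x (by omega)]
        exact h hx
    rw [key, Fm.lcVal]
    split_ifs with h
    · exact ⟨fun _ => hn, fun _ x _ _ => by omega⟩
    · refine ⟨fun H => ?_, fun _ x _ _ => by omega⟩
      by_contra hc
      have := H (b.lcVal v k) (by omega) (by omega)
      omega
  | later a iha =>
    intro n hn
    have key : (natModel v).toKMModel.force a.later n ↔ ∀ x : ℕ, x < n → x < a.lcVal v k := by
      change (∀ x : ℕ, x < n → _) ↔ _
      exact forall_congr' fun x => forall_congr' fun hx => iha x (by omega)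
    rw [key, Fm.lcVal]
    refine ⟨fun H => ?_, fun _ x _ => by omega⟩
    by_contra hc
    have := H (a.lcVal v k) (by omega)
    omega

theorem LCValid.lcVal_eq {φ : Fm} (h : LCValid φ) (v : ℕ → ℕ) (k : ℕ) : φ.lcVal v k = k := by
  by_contra hne
  have hlt := lt_of_le_of_ne (φ.lcVal_le v k) hne
  exact lt_irrefl _ ((natModel_force_iff v k φ _ hlt).1 (h (natModel v) (φ.lcVal v k : ℕ)))

theorem KMModel.force_persist (M : KMModel) (φ : Fm) {w x : M.W} (hw : M.force φ w)
    (h : M.R w x) : M.force φ x := by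
  induction φ with
  | atom p => exact M.persist p hw h
  | top => trivial
  | bot => exact hw
  | and a b iha ihb => exact ⟨iha hw.1, ihb hw.2⟩
  | or a b iha ihb => exact hw.imp iha ihb
  | imp a b _ _ =>
    rintro y (rfl | hy)
    · exact hw _ (Or.inr h)
    · exact hw y (Or.inr (M.trans h hy))
  | iimp a b _ _ => exact fun y hy => hw y (M.trans h hy)
  | later a _ => exact fun y hy => hw y (M.trans h hy)

/-- Every formula that fails somewhere fails at an `R`-maximal failing world. -/
theorem KMModel.exists_maximal_failure (M : KMModel) (φ : Fm) :
    ∃ m : M.W, ∀ w, ¬ M.force φ w → ¬ M.force φ m ∧ ∀ y, M.R m y → M.force φ y := by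
  by_cases hφ : ∃ w, ¬ M.force φ w
  · have wf : WellFounded (fun x y => M.R y x) :=
      wellFounded_iff_isEmpty_descending_chain.2 ⟨fun f => M.cwf ⟨f.1, f.2⟩⟩
    obtain ⟨m, hm, hmin⟩ := wf.has_min {w | ¬ M.force φ w} hφ
    exact ⟨m, fun _ _ => ⟨hm, fun y hy => not_not.1 fun hc => hmin y hc hy⟩⟩
  · exact ⟨M.nonempty.some, fun w hw => (hφ ⟨w, hw⟩).elim⟩

/-- The finite set of subformulas. -/
def Fm.subs : Fm → Finset Fm
  | .atom p => {.atom p}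
  | .top => {.top}
  | .bot => {.bot}
  | .and a b => insert (.and a b) (a.subs ∪ b.subs)
  | .or a b => insert (.or a b) (a.subs ∪ b.subs)
  | .imp a b => insert (.imp a b) (a.subs ∪ b.subs)
  | .iimp a b => insert (.iimp a b) (a.subs ∪ b.subs)
  | .later a => insert (.later a) a.subs

theorem Fm.self_mem_subs (φ : Fm) : φ ∈ φ.subs := by
  cases φ <;> simp [Fm.subs]

theorem Fm.add_lt_pair_pair {t a b : ℕ} (ht : 0 < t) : a + b < Nat.pair t (Nat.pair a b) := by
  have h₁ := Nat.add_le_pair a b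
  have h₂ := Nat.add_le_pair t (Nat.pair a b)
  omega

theorem Fm.card_subs_le (φ : Fm) : φ.subs.card ≤ φ.code + 1 := by
  have bin : ∀ (t : ℕ) (c a b : Fm), 2 ≤ t → a.subs.card ≤ a.code + 1 →
      b.subs.card ≤ b.code + 1 →
      (insert c (a.subs ∪ b.subs)).card ≤ Nat.pair t (Nat.pair a.code b.code) + 1 := by
    intro t c a b ht ha hb
    have h₁ := Finset.card_insert_le c (a.subs ∪ b.subs)
    have h₂ := Finset.card_union_le a.subs b.subs
    have h₃ := Nat.add_le_pair a.code b.code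
    have h₄ := Nat.add_le_pair t (Nat.pair a.code b.code)
    omega
  induction φ with
  | atom p => simp [Fm.subs]
  | top => simp [Fm.subs]
  | bot => simp [Fm.subs]
  | and a b iha ihb => exact bin 3 _ a b (by norm_num) iha ihb
  | or a b iha ihb => exact bin 4 _ a b (by norm_num) iha ihb
  | imp a b iha ihb => exact bin 5 _ a b (by norm_num) iha ihb
  | iimp a b iha ihb => exact bin 6 _ a b (by norm_num) iha ihb
  | later a iha =>
    have h₁ := Finset.card_insert_le a.later a.subs
    have h₂ := Nat.add_le_pair 7 a.code
    simp only [Fm.subs, Fm.code]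
    omega

open Classical in
/-- The worlds of `F` forcing `φ`. -/
noncomputable def KMModel.truthSet (M : KMModel) (F : Finset M.W) (φ : Fm) : Finset M.W :=
  F.filter (M.force φ)

theorem KMModel.mem_truthSet {M : KMModel} {F : Finset M.W} {φ : Fm} {w : M.W} :
    w ∈ M.truthSet F φ ↔ w ∈ F ∧ M.force φ w := by
  simp [KMModel.truthSet]

theorem KMModel.truthSet_subset (M : KMModel) (F : Finset M.W) (φ : Fm) :
    M.truthSet F φ ⊆ F := fun _ hw => (KMModel.mem_truthSet.1 hw).1

theorem LCModel.truthSet_total (M : LCModel) (F : Finset M.W) (a b : Fm) :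
    M.truthSet F a ⊆ M.truthSet F b ∨ M.truthSet F b ⊆ M.truthSet F a := by
  by_contra! h
  obtain ⟨h₁, h₂⟩ := h
  obtain ⟨x, hxa, hxb⟩ := Finset.not_subset.1 h₁
  obtain ⟨y, hyb, hya⟩ := Finset.not_subset.1 h₂
  rw [KMModel.mem_truthSet] at hxa hxb hyb hya
  rcases M.conn x y with rfl | h | h
  · exact hya hxa
  · exact hya ⟨hyb.1, M.force_persist a hxa.2 h⟩
  · exact hxb ⟨hxa.1, M.force_persist b hyb.2 h⟩

theorem LCModel.card_truthSet_le_iff (M : LCModel) (F : Finset M.W) (a b : Fm) :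
    (M.truthSet F a).card ≤ (M.truthSet F b).card ↔ M.truthSet F a ⊆ M.truthSet F b := by
  refine ⟨fun h => ?_, Finset.card_le_card⟩
  rcases M.truthSet_total F a b with h' | h'
  · exact h'
  · exact (Finset.eq_of_subset_of_card_le h' h).ge

/-- If `F` contains a maximal failing world for each subformula of `φ`, then the truth sets
within `F` obey the equations of `Fm.lcVal`. -/
theorem LCModel.lcVal_eq_card_truthSet (M : LCModel) (F : Finset M.W) (g : Fm → M.W)
    (hg : ∀ ψ w, ¬ M.force ψ w → ¬ M.force ψ (g ψ) ∧ ∀ y, M.R (g ψ) y → M.force ψ y)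
    (φ : Fm) (hF : ∀ ψ ∈ φ.subs, g ψ ∈ F) :
    φ.lcVal (fun p => (M.truthSet F (.atom p)).card) F.card = (M.truthSet F φ).card := by
  have up : ∀ {x : M.W} {ψ : Fm}, ¬ M.force ψ x → x = g ψ ∨ M.R x (g ψ) := by
    intro x ψ hx
    rcases M.conn x (g ψ) with h | h | h
    · exact Or.inl h
    · exact Or.inr h
    · exact (hx ((hg ψ x hx).2 x h)).elim
  have full : ∀ ψ : Fm, (∀ w ∈ F, M.force ψ w) → F.card = (M.truthSet F ψ).card := by
    intro ψ h
    congr 1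
    ext w
    simp only [KMModel.mem_truthSet]
    exact ⟨fun hw => ⟨hw, h w hw⟩, fun hw => hw.1⟩
  have addOne : ∀ (b c : Fm), g b ∈ F → ¬ M.force b (g b) →
      (∀ w, M.force c w ↔ ∀ x, M.R w x → M.force b x) →
      (M.truthSet F b).card + 1 = (M.truthSet F c).card := by
    classical
    intro b c hbF hb hc
    have hn : g b ∉ M.truthSet F b := fun h => hb (KMModel.mem_truthSet.1 h).2
    rw [← Finset.card_insert_of_notMem hn]
    congr 1
    ext w
    simp only [Finset.mem_insert, KMModel.mem_truthSet, hc]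
    constructor
    · rintro (rfl | hw)
      · exact ⟨hbF, (hg b _ hb).2⟩
      · exact ⟨hw.1, fun x hx => M.force_persist b hw.2 hx⟩
    · rintro ⟨hwF, hw⟩
      by_contra! h
      rcases up (h.2 hwF) with h' | h'
      · exact h.1 h'
      · exact hb (hw _ h')
  induction φ with
  | atom p => exact min_eq_left (Finset.card_le_card (M.truthSet_subset F _))
  | top => exact full _ fun _ _ => trivial
  | bot =>
    symm
    rw [Fm.lcVal, Finset.card_eq_zero, Finset.eq_empty_iff_forall_notMem]
    exact fun w hw => (KMModel.mem_truthSet.1 hw).2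
  | and a b iha ihb =>
    rw [Fm.lcVal, iha fun ψ h => hF ψ (by simp [Fm.subs, h]),
      ihb fun ψ h => hF ψ (by simp [Fm.subs, h])]
    rcases M.truthSet_total F a b with h | h
    · rw [min_eq_left (Finset.card_le_card h)]
      congr 1
      ext w
      have := @h w
      simp only [KMModel.mem_truthSet, KMModel.force] at this ⊢
      tauto
    · rw [min_eq_right (Finset.card_le_card h)]
      congr 1
      ext w
      have := @h w
      simp only [KMModel.mem_truthSet, KMModel.force] at this ⊢
      tauto
  | or a b iha ihb =>
    rw [Fm.lcVal, iha fun ψ h => hF ψ (by simp [Fm.subs, h]),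
      ihb fun ψ h => hF ψ (by simp [Fm.subs, h])]
    rcases M.truthSet_total F a b with h | h
    · rw [max_eq_right (Finset.card_le_card h)]
      congr 1
      ext w
      have := @h w
      simp only [KMModel.mem_truthSet, KMModel.force] at this ⊢
      tauto
    · rw [max_eq_left (Finset.card_le_card h)]
      congr 1
      ext w
      have := @h w
      simp only [KMModel.mem_truthSet, KMModel.force] at this ⊢
      tauto
  | imp a b iha ihb =>
    rw [Fm.lcVal, iha fun ψ h => hF ψ (by simp [Fm.subs, h]),
      ihb fun ψ h => hF ψ (by simp [Fm.subs, h])]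
    split_ifs with h <;> rw [M.card_truthSet_le_iff] at h
    · refine full _ fun w _ => ?_
      by_contra hw
      obtain ⟨hm, hmax⟩ := hg _ w hw
      apply hm
      rintro x (rfl | hx) hax
      · exact (KMModel.mem_truthSet.1
          (h (KMModel.mem_truthSet.2 ⟨hF _ (Fm.self_mem_subs _), hax⟩))).2
      · exact hmax x hx x (Or.inl rfl) hax
    · obtain ⟨z, hza, hzb⟩ := Finset.not_subset.1 h
      rw [KMModel.mem_truthSet] at hza hzb
      congr 1
      ext w
      simp only [KMModel.mem_truthSet]
      constructor
      · rintro ⟨hwF, hw⟩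
        refine ⟨hwF, ?_⟩
        rintro x (rfl | hx) _
        · exact hw
        · exact M.force_persist b hw hx
      · rintro ⟨hwF, hw⟩
        refine ⟨hwF, ?_⟩
        rcases M.conn w z with rfl | hwz | hzw
        · exact hw w (Or.inl rfl) hza.2
        · exact (hzb ⟨hza.1, hw z (Or.inr hwz) hza.2⟩).elim
        · exact hw w (Or.inl rfl) (M.force_persist a hza.2 hzw)
  | iimp a b iha ihb =>
    rw [Fm.lcVal, iha fun ψ h => hF ψ (by simp [Fm.subs, h]),
      ihb fun ψ h => hF ψ (by simp [Fm.subs, h])]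
    have hbF : g b ∈ F := hF b (by simp [Fm.subs, Fm.self_mem_subs])
    split_ifs with h <;> rw [M.card_truthSet_le_iff] at h
    · refine full _ fun w _ x _ hax => ?_
      by_contra hbx
      have hb := (hg b x hbx).1
      refine hb (KMModel.mem_truthSet.1 (h (KMModel.mem_truthSet.2 ⟨hbF, ?_⟩))).2
      rcases up hbx with h' | h'
      · exact h' ▸ hax
      · exact M.force_persist a hax h'
    · obtain ⟨z, hza, hzb⟩ := Finset.not_subset.1 h
      rw [KMModel.mem_truthSet] at hza hzb
      have hzb' : ¬ M.force b z := fun h => hzb ⟨hza.1, h⟩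
      have hb := (hg b z hzb').1
      have hag : M.force a (g b) := by
        rcases up hzb' with h' | h'
        · exact h' ▸ hza.2
        · exact M.force_persist a hza.2 h'
      refine addOne b _ hbF hb fun w => ⟨fun hw x hx => ?_, fun hw x hx _ => hw x hx⟩
      by_contra hbx
      refine hb (hw (g b) ?_ hag)
      rcases up hbx with h' | h'
      · exact h' ▸ hx
      · exact M.trans hx h'
  | later a iha =>
    rw [Fm.lcVal, iha fun ψ h => hF ψ (by simp [Fm.subs, h])]
    have haF : g a ∈ F := hF a (by simp [Fm.subs, Fm.self_mem_subs])
    by_cases ha : M.force a (g a)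
    · have hall : ∀ w, M.force a w := fun w => by
        by_contra hw
        exact (hg a w hw).1 ha
      rw [← full a fun w _ => hall w, ← full a.later fun w _ x _ => hall x]
      omega
    · have h := addOne a a.later haF ha fun w => Iff.rfl
      rw [h]
      exact min_eq_left (Finset.card_le_card (M.truthSet_subset F _))

/-- A non-valid formula is refuted by values bounded by its number of subformulas. -/
theorem exists_lcVal_ne_of_not_LCValid {φ : Fm} (h : ¬ LCValid φ) :
    ∃ (v : ℕ → ℕ) (k : ℕ), k ≤ φ.subs.card ∧ (∀ p, v p ≤ k) ∧ φ.lcVal v k ≠ k := by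
  classical
  simp only [LCValid, not_forall] at h
  obtain ⟨M, w, hw⟩ := h
  choose g hg using M.exists_maximal_failure
  refine ⟨_, (φ.subs.image g).card, Finset.card_image_le,
    fun p => Finset.card_le_card (M.truthSet_subset _ (.atom p)), ?_⟩
  rw [M.lcVal_eq_card_truthSet _ g hg φ fun ψ hψ => Finset.mem_image_of_mem g hψ]
  intro heq
  have hmem : g φ ∈ φ.subs.image g := Finset.mem_image_of_mem g φ.self_mem_subs
  rw [← Finset.eq_of_subset_of_card_le (M.truthSet_subset _ φ) heq.ge] at hmem
  exact (hg φ w hw).1 (KMModel.mem_truthSet.1 hmem).2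

theorem exists_nat_with_digits (b : ℕ) (n : ℕ) : ∀ d : ℕ → ℕ, (∀ i, d i < b) →
    ∃ x < b ^ n, ∀ i < n, x / b ^ i % b = d i := by
  induction n with
  | zero => exact fun d _ => ⟨0, by simp, by simp⟩
  | succ n ih =>
    intro d hd
    obtain ⟨x, hx, hxd⟩ := ih (fun i => d (i + 1)) fun i => hd (i + 1)
    have h0 := hd 0
    have hb : 0 < b := by omega
    refine ⟨d 0 + b * x, ?_, ?_⟩
    · rw [pow_succ']
      nlinarith
    · rintro (_ | i) hi
      · simp [Nat.mod_eq_of_lt h0]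
      · rw [pow_succ', ← Nat.div_div_eq_div_mul, Nat.add_mul_div_left _ _ hb,
          Nat.div_eq_of_lt h0, zero_add]
        exact hxd i (by omega)

/-- One step of the evaluation of `Fm.lcVal` on codes: `l` lists the values of the codes below
`n`, the depth is `y.1`, and the value of atom `p` is the digit `p + 1` of `y.2.1` in
base `y.2.2`. -/
def lcStep (y : ℕ × ℕ × ℕ) (n : ℕ) (l : List ℕ) : ℕ :=
  if n.unpair.1 = 0 then min (y.2.1 / y.2.2 ^ (n.unpair.2 + 1) % y.2.2) y.1
  else if n.unpair.1 = 1 then y.1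
  else if n.unpair.1 = 2 then 0
  else if n.unpair.1 = 3 then
    min (l.getD n.unpair.2.unpair.1 0) (l.getD n.unpair.2.unpair.2 0)
  else if n.unpair.1 = 4 then
    max (l.getD n.unpair.2.unpair.1 0) (l.getD n.unpair.2.unpair.2 0)
  else if n.unpair.1 = 5 then
    if l.getD n.unpair.2.unpair.1 0 ≤ l.getD n.unpair.2.unpair.2 0 then y.1
    else l.getD n.unpair.2.unpair.2 0
  else if n.unpair.1 = 6 then
    if l.getD n.unpair.2.unpair.1 0 ≤ l.getD n.unpair.2.unpair.2 0 then y.1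
    else l.getD n.unpair.2.unpair.2 0 + 1
  else min (l.getD n.unpair.2 0 + 1) y.1

/-- The values of all codes below `n`. -/
def lcTable (y : ℕ × ℕ × ℕ) (n : ℕ) : List ℕ :=
  Nat.rec [] (fun m l => l ++ [lcStep y m l]) n

theorem length_lcTable (y : ℕ × ℕ × ℕ) (n : ℕ) : (lcTable y n).length = n := by
  induction n with
  | zero => rfl
  | succ n ih => simpa [lcTable] using ih

theorem getD_lcTable (y : ℕ × ℕ × ℕ) {m n : ℕ} (h : m < n) :
    (lcTable y n).getD m 0 = lcStep y m (lcTable y m) := by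
  induction n with
  | zero => omega
  | succ n ih =>
    have hl := length_lcTable y n
    change (lcTable y n ++ [lcStep y n (lcTable y n)]).getD m 0 = _
    rcases Nat.lt_succ_iff_lt_or_eq.1 h with h | rfl
    · rw [List.getD_append _ _ _ _ (by omega), ih h]
    · rw [List.getD_append_right _ _ _ _ (by omega)]
      simp [hl]

theorem lcStep_code (y : ℕ × ℕ × ℕ) (φ : Fm) :
    lcStep y φ.code (lcTable y φ.code) =
      φ.lcVal (fun p => y.2.1 / y.2.2 ^ (p + 1) % y.2.2) y.1 := by
  have left : ∀ {t : ℕ} (a b : ℕ), 0 < t → a < Nat.pair t (Nat.pair a b) := by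
    intro t a b ht
    have := Fm.add_lt_pair_pair (a := a) (b := b) ht
    omega
  have right : ∀ {t : ℕ} (a b : ℕ), 0 < t → b < Nat.pair t (Nat.pair a b) := by
    intro t a b ht
    have := Fm.add_lt_pair_pair (a := a) (b := b) ht
    omega
  induction φ with
  | atom p => simp [Fm.code, Fm.lcVal, lcStep]
  | top => simp [Fm.code, Fm.lcVal, lcStep]
  | bot => simp [Fm.code, Fm.lcVal, lcStep]
  | and a b iha ihb | or a b iha ihb | imp a b iha ihb | iimp a b iha ihb =>
    rw [Fm.code, lcStep, Fm.lcVal, ← iha, ← ihb]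
    simp only [Nat.unpair_pair]
    rw [getD_lcTable y (left _ _ (by norm_num)), getD_lcTable y (right _ _ (by norm_num))]
    simp
  | later a iha =>
    rw [Fm.code, lcStep, Fm.lcVal, ← iha]
    simp only [Nat.unpair_pair]
    rw [getD_lcTable y (m := a.code) (by have := Nat.add_le_pair 7 a.code; omega)]
    simp

theorem primrec_pow : Primrec₂ ((· ^ ·) : ℕ → ℕ → ℕ) := by
  refine (Primrec.nat_rec' (f := fun p : ℕ × ℕ => p.2) (g := fun _ => 1)
    (h := fun p q => q.2 * p.1) Primrec.snd (Primrec.const 1)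
    (Primrec.nat_mul.comp (Primrec.snd.comp Primrec.snd)
      (Primrec.fst.comp Primrec.fst))).of_eq fun p => ?_
  induction p.2 with
  | zero => rfl
  | succ n ih => simp [pow_succ, ih]

theorem primrec_lcStep :
    Primrec fun q : (ℕ × ℕ × ℕ) × ℕ × List ℕ => lcStep q.1 q.2.1 q.2.2 := by
  have hk : Primrec fun q : (ℕ × ℕ × ℕ) × ℕ × List ℕ => q.1.1 := Primrec.fst.comp Primrec.fst
  have hx : Primrec fun q : (ℕ × ℕ × ℕ) × ℕ × List ℕ => q.1.2.1 :=
    Primrec.fst.comp (Primrec.snd.comp Primrec.fst)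
  have hb : Primrec fun q : (ℕ × ℕ × ℕ) × ℕ × List ℕ => q.1.2.2 :=
    Primrec.snd.comp (Primrec.snd.comp Primrec.fst)
  have hl : Primrec fun q : (ℕ × ℕ × ℕ) × ℕ × List ℕ => q.2.2 :=
    Primrec.snd.comp Primrec.snd
  have hn : Primrec fun q : (ℕ × ℕ × ℕ) × ℕ × List ℕ => q.2.1.unpair :=
    Primrec.unpair.comp (Primrec.fst.comp Primrec.snd)
  have ht := Primrec.fst.comp hn
  have hr := Primrec.snd.comp hn
  have hr' := Primrec.unpair.comp hr
  have hA := (Primrec.list_getD 0).comp hl (Primrec.fst.comp hr')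
  have hB := (Primrec.list_getD 0).comp hl (Primrec.snd.comp hr')
  have hC := (Primrec.list_getD 0).comp hl hr
  have tag : ∀ t : ℕ,
      PrimrecPred fun q : (ℕ × ℕ × ℕ) × ℕ × List ℕ => q.2.1.unpair.1 = t :=
    fun t => Primrec.eq.comp ht (Primrec.const t)
  have hAB := Primrec.nat_le.comp hA hB
  exact Primrec.ite (tag 0)
    (Primrec.nat_min.comp (Primrec.nat_mod.comp (Primrec.nat_div.comp hx
      (primrec_pow.comp hb (Primrec.succ.comp hr))) hb) hk)
    (Primrec.ite (tag 1) hk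
    (Primrec.ite (tag 2) (Primrec.const 0)
    (Primrec.ite (tag 3) (Primrec.nat_min.comp hA hB)
    (Primrec.ite (tag 4) (Primrec.nat_max.comp hA hB)
    (Primrec.ite (tag 5) (Primrec.ite hAB hk hB)
    (Primrec.ite (tag 6) (Primrec.ite hAB hk (Primrec.succ.comp hB))
    (Primrec.nat_min.comp (Primrec.succ.comp hC) hk)))))))

theorem primrec_lcTable : Primrec₂ lcTable := by
  refine Primrec.nat_rec (f := fun _ : ℕ × ℕ × ℕ => ([] : List ℕ))
    (g := fun y q => q.2 ++ [lcStep y q.1 q.2]) (Primrec.const []) ?_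
  exact Primrec.list_concat.comp (Primrec.snd.comp Primrec.snd) primrec_lcStep

/-- All values bounded by `c + 1` give the code `c` the maximal value. The digits in base
`c + 2` of the quantified number encode the depth and the values of the atoms. -/
def LCCheck (c : ℕ) : Prop :=
  ∀ x < (c + 2) ^ (c + 2),
    lcStep (x % (c + 2), x, c + 2) c (lcTable (x % (c + 2), x, c + 2) c) = x % (c + 2)

theorem primrecPred_LCCheck : PrimrecPred LCCheck := by
  have hb : Primrec fun q : ℕ × ℕ => q.2 + 2 :=
    Primrec.nat_add.comp Primrec.snd (Primrec.const 2)
  have hk : Primrec fun q : ℕ × ℕ => q.1 % (q.2 + 2) := Primrec.nat_mod.comp Primrec.fst hb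
  have hy : Primrec fun q : ℕ × ℕ => (q.1 % (q.2 + 2), q.1, q.2 + 2) :=
    Primrec.pair hk (Primrec.pair Primrec.fst hb)
  have hs := primrec_lcStep.comp (Primrec.pair hy
    (Primrec.pair Primrec.snd (primrec_lcTable.comp hy Primrec.snd)))
  have hR : PrimrecRel fun x c : ℕ =>
      lcStep (x % (c + 2), x, c + 2) c (lcTable (x % (c + 2), x, c + 2) c) = x % (c + 2) :=
    Primrec.eq.comp hs hk
  have hc : Primrec fun c : ℕ => c + 2 := Primrec.nat_add.comp Primrec.id (Primrec.const 2)
  exact hR.forall_lt.comp (primrec_pow.comp hc hc) Primrec.id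

theorem Fm.lcVal_congr {v v' : ℕ → ℕ} (k : ℕ) (φ : Fm) (h : ∀ p ≤ φ.code, v p = v' p) :
    φ.lcVal v k = φ.lcVal v' k := by
  have bin : ∀ {t : ℕ} {a b : Fm}, 0 < t →
      (∀ p ≤ Nat.pair t (Nat.pair a.code b.code), v p = v' p) →
      (∀ p ≤ a.code, v p = v' p) ∧ ∀ p ≤ b.code, v p = v' p := by
    intro t a b ht h
    have := Fm.add_lt_pair_pair (a := a.code) (b := b.code) ht
    exact ⟨fun p hp => h p (by omega), fun p hp => h p (by omega)⟩
  induction φ with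
  | atom p => rw [Fm.lcVal, Fm.lcVal, h p (Nat.right_le_pair 0 p)]
  | top => rfl
  | bot => rfl
  | and a b iha ihb | or a b iha ihb | imp a b iha ihb | iimp a b iha ihb =>
    obtain ⟨ha, hb⟩ := bin (by norm_num) h
    rw [Fm.lcVal, Fm.lcVal, iha ha, ihb hb]
  | later a iha =>
    rw [Fm.lcVal, Fm.lcVal, iha fun p hp => h p (hp.trans (Nat.right_le_pair 7 a.code))]

theorem LCCheck_code_iff (φ : Fm) : LCCheck φ.code ↔ LCValid φ := by
  constructor
  · intro h
    by_contra hφ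
    obtain ⟨v, k, hk, hv, hne⟩ := exists_lcVal_ne_of_not_LCValid hφ
    have hkc : k < φ.code + 2 := by have := φ.card_subs_le; omega
    obtain ⟨x, hx, hxd⟩ := exists_nat_with_digits (φ.code + 2) (φ.code + 2)
      (fun i => Nat.casesOn i k v) fun i => by
        cases i with
        | zero => exact hkc
        | succ p => exact (hv p).trans_lt hkc
    have hxk : x % (φ.code + 2) = k := by simpa using hxd 0 (by omega)
    have hx' := h x hx
    rw [lcStep_code, hxk] at hx'
    refine hne (Eq.trans (φ.lcVal_congr k fun p hp => ?_) hx')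
    exact (hxd (p + 1) (by omega)).symm
  · intro h x _
    rw [lcStep_code]
    exact h.lcVal_eq _ _

/-- LC⊳ is decidable: a computable function decides validity (via codes). -/
theorem lc_decidable :
    ∃ f : ℕ → Bool, Computable f ∧ ∀ φ : Fm, (f φ.code = true ↔ LCValid φ) := by
  obtain ⟨_, hdec⟩ := primrecPred_LCCheck
  exact ⟨fun c => decide (LCCheck c), hdec.to_comp, fun φ => by
    rw [decide_eq_true_iff, LCCheck_code_iff]⟩
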